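/- Let (σ, v) be an oriented valuated matroid of rank r on a finite linearly ordered set E with values in a linearly ordered abelian group Γ. Let s : E → {+1, −1} and x : E → Γ (so the pair (s, x) is a signed tropical point all of whose coordinates are nonzero). Then the following are equivalent: (i) for every signed valuated circuit C = (c, w) of (σ, v), both +1 and −1 occur among the products s_i·c_i taken over those i ∈ E with w_i ≠ ∞ for which w_i + x_i is minimal over {j ∈ E : w_j ≠ ∞} (i.e. (s,x) is orthogonal over 𝕊[Γ] to every circuit of (σ,v)); (ii) for every nonzero circuit vector c'_τ of the initial chirotope σ^x, both +1 and −1 occur among the products s_i·(c'_τ)_i over i in the support of c'_τ (i.e. s is a covector of the initial oriented matroid σ^x). (This is the toric case of the covector characterisation, Theorem D(iii)/Proposition on covectors, for the perfect tract F = 𝕊: a signed tropical point lies in the signed tropical linear space of (σ,v) iff its sign part is a covector of its initial oriented matroid.) -/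

import Mathlib

open scoped Classical

/-- Subtraction of a group element from `Γ ∪ {∞}`, with `∞ - g = ∞`. -/
def wsub {Γ : Type*} [AddCommGroup Γ] [LinearOrder Γ] [IsOrderedAddMonoid Γ] (x : WithTop Γ) (g : Γ) : WithTop Γ :=
  x.map fun γ => γ - g

/-- `sign(j; I, J) = (-1)^ℓ ∈ {+1, -1}`, where `ℓ` is the number of `j' ∈ J` with `j < j'` plus
the number of `i ∈ I` with `j < i`. -/
def ssign {E : Type*} [LinearOrder E] (j : E) (I J : Finset E) : SignType :=
  (-1 : SignType) ^ ((J.filter fun j' => j < j').card + (I.filter fun i => j < i).card)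

/-- The pair `(σ, v)` is an oriented valuated matroid (a strong `𝕊[Γ]`-matroid) of rank `r`:
for every `(r-1)`-subset `I` and `(r+1)`-subset `J`, letting `m` be the minimum of
`v(I∪{j}) + v(J∖{j})` over `j ∈ J∖I`, either `m = ∞` or both `+1` and `-1` occur among the
products `sign(j;I,J)·σ(I∪{j})·σ(J∖{j})` over the minimisers. -/
def OrientedValuatedMatroid {E : Type*} [Fintype E] [LinearOrder E]
    {Γ : Type*} [AddCommGroup Γ] [LinearOrder Γ] [IsOrderedAddMonoid Γ]
    (σ : Finset E → SignType) (v : Finset E → WithTop Γ) (r : ℕ) : Prop :=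
  ∀ I J : Finset E, I.card + 1 = r → J.card = r + 1 →
    (∀ j ∈ J \ I, v (insert j I) + v (J.erase j) = ⊤) ∨
    ((∃ j ∈ J \ I,
        (∀ k ∈ J \ I, v (insert j I) + v (J.erase j) ≤ v (insert k I) + v (J.erase k)) ∧
        ssign j I J * σ (insert j I) * σ (J.erase j) = 1) ∧
     (∃ j ∈ J \ I,
        (∀ k ∈ J \ I, v (insert j I) + v (J.erase j) ≤ v (insert k I) + v (J.erase k)) ∧
        ssign j I J * σ (insert j I) * σ (J.erase j) = -1))

/-- `χ` is a chirotope of rank `r` on `E`: it is not identically `0` on `r`-subsets, and for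
every `(r-1)`-subset `I` and `(r+1)`-subset `J`, either all products
`sign(j;I,J)·χ(I∪{j})·χ(J∖{j})`, `j ∈ J∖I`, are `0`, or both `+1` and `-1` occur among them. -/
def IsChirotope {E : Type*} [Fintype E] [LinearOrder E]
    (χ : Finset E → SignType) (r : ℕ) : Prop :=
  (∃ B : Finset E, B.card = r ∧ χ B ≠ 0) ∧
  ∀ I J : Finset E, I.card + 1 = r → J.card = r + 1 →
    (∀ j ∈ J \ I, ssign j I J * χ (insert j I) * χ (J.erase j) = 0) ∨
    ((∃ j ∈ J \ I, ssign j I J * χ (insert j I) * χ (J.erase j) = 1) ∧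
     (∃ j ∈ J \ I, ssign j I J * χ (insert j I) * χ (J.erase j) = -1))

/-- The initial sign function `σ^u`: `σ^u(B) = σ(B)` if `v(B) ≠ ∞` and `v(B) - ∑_{i∈B} u_i` is
minimal among all `r`-subsets, and `σ^u(B) = 0` otherwise. -/
noncomputable def initSign {E : Type*} [Fintype E] {Γ : Type*} [AddCommGroup Γ] [LinearOrder Γ] [IsOrderedAddMonoid Γ]
    (σ : Finset E → SignType) (v : Finset E → WithTop Γ) (r : ℕ) (u : E → Γ)
    (B : Finset E) : SignType :=
  if v B ≠ ⊤ ∧ ∀ B' : Finset E, B'.card = r →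
      wsub (v B) (∑ i ∈ B, u i) ≤ wsub (v B') (∑ i ∈ B', u i)
  then σ B else 0

/-- The sign part `c` of the signed valuated vector `C_τ`: `c_{i_k} = (-1)^k · σ(τ∖{i_k})` for
`i_k` the `k`-th smallest element of `τ`, and `0` outside `τ`. -/
def cVec {E : Type*} [LinearOrder E] (σ : Finset E → SignType) (τ : Finset E) :
    E → SignType :=
  fun i => if i ∈ τ then (-1 : SignType) ^ (τ.filter fun a => a < i).card * σ (τ.erase i) else 0

/-- The valuation part `w` of the signed valuated vector `C_τ`: `w_i = v(τ∖{i})` for `i ∈ τ`,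
and `∞` outside `τ`. -/
def wVec {E : Type*} [DecidableEq E] {Γ : Type*} [AddCommGroup Γ] [LinearOrder Γ] [IsOrderedAddMonoid Γ]
    (v : Finset E → WithTop Γ) (τ : Finset E) : E → WithTop Γ :=
  fun i => if i ∈ τ then v (τ.erase i) else ⊤

/-- The initial vector `C^u` of a signed valuated vector `C = (c, w)`: `(C^u)_i = c_i` if
`w_i ≠ ∞` and `w_i + u_i` is minimal, and `0` otherwise. -/
noncomputable def initVec {E : Type*} [Fintype E] {Γ : Type*} [AddCommGroup Γ] [LinearOrder Γ] [IsOrderedAddMonoid Γ]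
    (c : E → SignType) (w : E → WithTop Γ) (u : E → Γ) : E → SignType :=
  fun i => if w i ≠ ⊤ ∧ ∀ j, w i + (u i : WithTop Γ) ≤ w j + (u j : WithTop Γ)
    then c i else 0

/-- The circuit vector `c'_τ` of the initial chirotope `σ^u`:
`(c'_τ)_{i_k} = (-1)^k · σ^u(τ∖{i_k})` on `τ` and `0` elsewhere. -/
noncomputable def cPrime {E : Type*} [Fintype E] [LinearOrder E]
    {Γ : Type*} [AddCommGroup Γ] [LinearOrder Γ] [IsOrderedAddMonoid Γ]
    (σ : Finset E → SignType) (v : Finset E → WithTop Γ) (r : ℕ) (u : E → Γ)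
    (τ : Finset E) : E → SignType :=
  fun i => if i ∈ τ then
      (-1 : SignType) ^ (τ.filter fun a => a < i).card * initSign σ v r u (τ.erase i)
    else 0


theorem minty_aux {E : Type*} [Fintype E] (P Q : (E → SignType) → Prop) (e : E)
    (orth : ∀ C D, P C → Q D → C e = 1 → D e = 1 → ∃ i, C i * D i = -1)
    (base : ∀ B : Finset E, e ∉ B →
      (∃ C, P C ∧ C e = 1 ∧ ∀ i, i ≠ e → i ∉ B → C i = 0) ∨
      (∃ D, Q D ∧ D e = 1 ∧ ∀ i ∈ B, D i = 0)) (F : Finset E) :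
    ∀ B : Finset E, e ∉ B → e ∉ F → Disjoint F B →
      (∃ C, P C ∧ C e = 1 ∧ (∀ i ∈ F, 0 ≤ C i) ∧ ∀ i, i ≠ e → i ∉ B → i ∉ F → C i = 0) ∨
      (∃ D, Q D ∧ D e = 1 ∧ (∀ i ∈ F, 0 ≤ D i) ∧ ∀ i ∈ B, D i = 0) := by
  induction F using Finset.induction_on with
  | empty =>
    intro B hB _ _
    rcases base B hB with ⟨C, h1, h2, h3⟩ | ⟨D, h1, h2, h3⟩
    · exact Or.inl ⟨C, h1, h2, by simp, fun i a b _ => h3 i a b⟩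
    · exact Or.inr ⟨D, h1, h2, by simp, h3⟩
  | insert f F hf ih =>
    intro B hB heF hd
    have hfe : e ≠ f ∧ e ∉ F := by simpa using heF
    have hd' : f ∉ B ∧ Disjoint F B := by simpa using hd
    rcases ih B hB hfe.2 hd'.2 with ⟨C, h1, h2, h3, h4⟩ | ⟨D, d1, d2, d3, d4⟩
    · refine Or.inl ⟨C, h1, h2, ?_, ?_⟩
      · intro i hi
        rcases Finset.mem_insert.1 hi with rfl | hi
        · rw [h4 i (Ne.symm hfe.1) hd'.1 hf]
        · exact h3 i hi
      · intro i a b c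
        exact h4 i a b (fun h => c (Finset.mem_insert_of_mem h))
    have hdis : Disjoint F (insert f B) := by
      rw [Finset.disjoint_insert_right]; exact ⟨hf, hd'.2⟩
    rcases ih (insert f B) (by simp [hfe.1, hB]) hfe.2 hdis with
      ⟨C, h1, h2, h3, h4⟩ | ⟨D, h1, h2, h3, h4⟩
    · by_cases hc : 0 ≤ C f
      · refine Or.inl ⟨C, h1, h2, ?_, ?_⟩
        · intro i hi
          rcases Finset.mem_insert.1 hi with rfl | hi
          · exact hc
          · exact h3 i hi
        · intro i a b c
          simp only [Finset.mem_insert, not_or] at c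
          exact h4 i a (by simp [b, c.1]) c.2
      by_cases hdf : 0 ≤ D f
      · refine Or.inr ⟨D, d1, d2, ?_, d4⟩
        intro i hi
        rcases Finset.mem_insert.1 hi with rfl | hi
        · exact hdf
        · exact d3 i hi
      exfalso
      obtain ⟨i, hi⟩ := orth C D h1 d1 h2 d2
      have key1 : ∀ a b : SignType, 0 ≤ a → 0 ≤ b → a * b ≠ -1 := by decide
      have key2 : ∀ a b : SignType, ¬ 0 ≤ a → ¬ 0 ≤ b → a * b ≠ -1 := by decide
      by_cases hie : i = e
      · subst hie; rw [h2, d2] at hi; exact absurd hi (by decide)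
      by_cases hif : i = f
      · subst hif; exact key2 _ _ hc hdf hi
      by_cases hiF : i ∈ F
      · exact key1 _ _ (h3 i hiF) (d3 i hiF) hi
      by_cases hiB : i ∈ B
      · rw [d4 i hiB, mul_zero] at hi; exact absurd hi (by decide)
      · rw [h4 i hie (by simp [hif, hiB]) hiF, zero_mul] at hi; exact absurd hi (by decide)
    · refine Or.inr ⟨D, h1, h2, ?_, fun i hi => h4 i (Finset.mem_insert_of_mem hi)⟩
      intro i hi
      rcases Finset.mem_insert.1 hi with rfl | hi
      · rw [h4 i (Finset.mem_insert_self _ _)]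
      · exact h3 i hi

theorem minty {E : Type*} [Fintype E] (P Q : (E → SignType) → Prop) (e : E)
    (orth : ∀ C D, P C → Q D → C e = 1 → D e = 1 → ∃ i, C i * D i = -1)
    (base : ∀ B : Finset E, e ∉ B →
      (∃ C, P C ∧ C e = 1 ∧ ∀ i, i ≠ e → i ∉ B → C i = 0) ∨
      (∃ D, Q D ∧ D e = 1 ∧ ∀ i ∈ B, D i = 0)) :
    (∃ C, P C ∧ C e = 1 ∧ (∀ i, 0 ≤ C i)) ∨ (∃ D, Q D ∧ D e = 1 ∧ (∀ i, 0 ≤ D i)) := by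
  have key : ∀ a : SignType, a = 1 → 0 ≤ a := by decide
  rcases minty_aux P Q e orth base (Finset.univ.erase e) ∅ (by simp) (by simp) (by simp) with
    ⟨C, h1, h2, h3, h4⟩ | ⟨C, h1, h2, h3, h4⟩
  · refine Or.inl ⟨C, h1, h2, fun i => ?_⟩
    by_cases h : i = e
    · subst h; exact key _ h2
    · exact h3 i (by simp [h])
  · refine Or.inr ⟨C, h1, h2, fun i => ?_⟩
    by_cases h : i = e
    · subst h; exact key _ h2
    · exact h3 i (by simp [h])

section aux
set_option linter.unusedSectionVars false
variable {E : Type*} [Fintype E] [LinearOrder E] {Γ : Type*} [AddCommGroup Γ] [LinearOrder Γ]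
  [IsOrderedAddMonoid Γ]

/-- initial bases -/
def InitB (v : Finset E → WithTop Γ) (r : ℕ) (x : E → Γ) (B : Finset E) : Prop :=
  ∃ b : Γ, v B = b ∧ ∀ (B' : Finset E) (b' : Γ), B'.card = r → v B' = b' →
    b - ∑ i ∈ B, x i ≤ b' - ∑ i ∈ B', x i

/-- minimal coordinates of a circuit -/
def CMin (v : Finset E → WithTop Γ) (x : E → Γ) (τ : Finset E) (i : E) : Prop :=
  i ∈ τ ∧ ∃ a : Γ, v (τ.erase i) = a ∧ ∀ j ∈ τ, ∀ a' : Γ, v (τ.erase j) = a' → a + x i ≤ a' + x j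

theorem initSign_eq (σ : Finset E → SignType) (v : Finset E → WithTop Γ) (r : ℕ) (x : E → Γ)
    (B : Finset E) : initSign σ v r x B = if InitB v r x B then σ B else 0 := by
  unfold initSign
  congr 1
  apply propext
  constructor
  · rintro ⟨h1, h2⟩
    obtain ⟨b, hb⟩ := WithTop.ne_top_iff_exists.1 h1
    refine ⟨b, hb.symm, fun B' b' hB' hb' => ?_⟩
    have := h2 B' hB'
    rw [← hb, hb'] at this
    exact WithTop.coe_le_coe.1 this
  · rintro ⟨b, hb, h2⟩
    refine ⟨by simp [hb], fun B' hB' => ?_⟩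
    by_cases h : v B' = ⊤
    · rw [h]; exact le_top
    · obtain ⟨b', hb'⟩ := WithTop.ne_top_iff_exists.1 h
      have := h2 B' b' hB' hb'.symm
      rw [← hb', hb]
      exact WithTop.coe_le_coe.2 this

theorem cmin_iff (v : Finset E → WithTop Γ) (x : E → Γ) (τ : Finset E) (i : E) :
    CMin v x τ i ↔ (wVec v τ i ≠ ⊤ ∧ (∀ j : E, wVec v τ j ≠ ⊤ →
              wVec v τ i + (x i : WithTop Γ) ≤ wVec v τ j + (x j : WithTop Γ))) := by
  constructor
  · rintro ⟨hi, a, ha, h⟩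
    have hw : wVec v τ i = a := by simp [wVec, hi, ha]
    refine ⟨by simp [hw], fun j hj => ?_⟩
    have hjτ : j ∈ τ := by
      by_contra hc
      exact hj (by simp [wVec, hc])
    obtain ⟨b, hb⟩ := WithTop.ne_top_iff_exists.1 hj
    have := h j hjτ b (by rw [hb]; simp [wVec, hjτ])
    rw [hw, ← hb]
    exact_mod_cast this
  · rintro ⟨h1, h⟩
    have hi : i ∈ τ := by
      by_contra hc
      exact h1 (by simp [wVec, hc])
    obtain ⟨a, ha⟩ := WithTop.ne_top_iff_exists.1 h1
    refine ⟨hi, a, by rw [ha]; simp [wVec, hi], fun j hj a' ha' => ?_⟩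
    have hw : wVec v τ j = a' := by simp [wVec, hj, ha']
    have := h j (by simp [hw])
    rw [hw, ← ha] at this
    exact_mod_cast this

theorem cmin_exists (v : Finset E → WithTop Γ) (x : E → Γ) (τ : Finset E)
    (h : ∃ i ∈ τ, v (τ.erase i) ≠ ⊤) : ∃ i, CMin v x τ i := by
  obtain ⟨i0, h0, h0'⟩ := h
  obtain ⟨i, hi, him⟩ := Finset.exists_min_image τ
    (fun i => v (τ.erase i) + (x i : WithTop Γ)) ⟨i0, h0⟩
  have hne : v (τ.erase i) ≠ ⊤ := by
    intro ht
    have := him i0 h0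
    simp [ht, h0'] at this
  refine ⟨i, (cmin_iff v x τ i).2 ⟨by simpa [wVec, hi] using hne, fun j hj => ?_⟩⟩
  have hjτ : j ∈ τ := by
    by_contra hc
    exact hj (by simp [wVec, hc])
  simpa [wVec, hi, hjτ] using him j hjτ

theorem cmin_of_initB {v : Finset E → WithTop Γ} {r : ℕ} {x : E → Γ} {τ : Finset E}
    (hτ : τ.card = r + 1) {i : E} (hi : i ∈ τ) (h : InitB v r x (τ.erase i)) : CMin v x τ i := by
  obtain ⟨b, hb, h⟩ := h
  refine ⟨hi, b, hb, fun j hj a' ha' => ?_⟩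
  have := h (τ.erase j) a' (by rw [Finset.card_erase_of_mem hj, hτ]; rfl) ha'
  rw [Finset.sum_erase_eq_sub hi, Finset.sum_erase_eq_sub hj] at this
  have h2 := add_le_add_left this (∑ i ∈ τ, x i)
  have e1 : ∀ b y S : Γ, b - (S - y) + S = b + y := by intros; abel
  rwa [e1, e1] at h2

theorem initB_of_cmin {v : Finset E → WithTop Γ} {r : ℕ} {x : E → Γ} {τ : Finset E}
    {i j : E} (hi : i ∈ τ) (h : InitB v r x (τ.erase i)) (hj : CMin v x τ j) :
    InitB v r x (τ.erase j) := by
  obtain ⟨b, hb, h⟩ := h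
  obtain ⟨hjτ, a, ha, hj⟩ := hj
  refine ⟨a, ha, fun B' b' hB' hb' => le_trans ?_ (h B' b' hB' hb')⟩
  have := hj i hi b hb
  rw [Finset.sum_erase_eq_sub hi, Finset.sum_erase_eq_sub hjτ]
  have h2 := add_le_add_left this (-∑ i ∈ τ, x i)
  have e1 : ∀ b y S : Γ, b + y + -S = b - (S - y) := by intros; abel
  rwa [e1, e1] at h2

theorem neg_one_pow_sign (n : ℕ) : (-1 : SignType) ^ n = 1 ∨ (-1 : SignType) ^ n = -1 := by
  induction n with
  | zero => left; rfl
  | succ n ih =>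
    rw [pow_succ]
    rcases ih with h | h <;> rw [h] <;> decide

theorem cPrime_eq (σ : Finset E → SignType) (v : Finset E → WithTop Γ) (r : ℕ) (x : E → Γ)
    (τ : Finset E) (i : E) : cPrime σ v r x τ i =
      if i ∈ τ ∧ InitB v r x (τ.erase i) then cVec σ τ i else 0 := by
  unfold cPrime cVec
  rw [initSign_eq]
  by_cases h1 : i ∈ τ <;> by_cases h2 : InitB v r x (τ.erase i) <;> simp [h1, h2]

theorem cVec_ne_zero {σ : Finset E → SignType} {v : Finset E → WithTop Γ} {r : ℕ}
    (hσv : ∀ B : Finset E, B.card = r → (σ B = 0 ↔ v B = ⊤)) {τ : Finset E}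
    (hτ : τ.card = r + 1) (i : E) : cVec σ τ i ≠ 0 ↔ i ∈ τ ∧ v (τ.erase i) ≠ ⊤ := by
  unfold cVec
  by_cases hi : i ∈ τ
  · have hc : (τ.erase i).card = r := by rw [Finset.card_erase_of_mem hi, hτ]; rfl
    have := hσv _ hc
    rcases neg_one_pow_sign ((τ.filter fun a => a < i).card) with h | h <;>
      simp [hi, h, ← this]
  · simp [hi]

theorem cVec_ne_zero_of_cmin {σ : Finset E → SignType} {v : Finset E → WithTop Γ} {r : ℕ}
    {x : E → Γ}
    (hσv : ∀ B : Finset E, B.card = r → (σ B = 0 ↔ v B = ⊤)) {τ : Finset E}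
    (hτ : τ.card = r + 1) {i : E} (h : CMin v x τ i) : cVec σ τ i ≠ 0 := by
  obtain ⟨h1, a, ha, _⟩ := h
  exact (cVec_ne_zero hσv hτ i).2 ⟨h1, by simp [ha]⟩

/-- cocircuit vectors of the initial matroid -/
noncomputable def dVec (σ : Finset E → SignType) (v : Finset E → WithTop Γ) (r : ℕ) (x : E → Γ)
    (I : Finset E) : E → SignType :=
  fun j => if j ∉ I ∧ InitB v r x (insert j I) then
    (-1 : SignType) ^ (I.filter fun i => j < i).card * σ (insert j I) else 0

theorem dVec_ne_zero {σ : Finset E → SignType} {v : Finset E → WithTop Γ} {r : ℕ} {x : E → Γ}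
    (hσv : ∀ B : Finset E, B.card = r → (σ B = 0 ↔ v B = ⊤)) {I : Finset E}
    (hI : I.card + 1 = r) (j : E) :
    dVec σ v r x I j ≠ 0 ↔ j ∉ I ∧ InitB v r x (insert j I) := by
  unfold dVec
  by_cases hj : j ∉ I ∧ InitB v r x (insert j I)
  · have hc : (insert j I).card = r := by rw [Finset.card_insert_of_notMem hj.1, hI]
    have h2 : σ (insert j I) ≠ 0 := by
      rw [Ne, hσv _ hc]
      obtain ⟨b, hb, _⟩ := hj.2
      simp [hb]
    rcases neg_one_pow_sign ((I.filter fun i => j < i).card) with h | h <;>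
      simp [hj, h, h2]
  · simp [hj]

theorem ssign_eq {σ : Finset E → SignType} {v : Finset E → WithTop Γ} {r : ℕ} {x : E → Γ}
    {I τ : Finset E} (hτ : τ.card = r + 1) {j : E} (hj : j ∈ τ) (hjI : j ∉ I)
    (hB : InitB v r x (insert j I)) :
    ssign j I τ * σ (insert j I) * σ (τ.erase j) =
      (-1 : SignType) ^ r * (cVec σ τ j * dVec σ v r x I j) := by
  have hcard : (τ.filter fun a => a < j).card + (τ.filter fun a => j < a).card = r := by
    have h1 : (τ.filter fun a => a < j).card + (τ.filter fun a => ¬ a < j).card = τ.card :=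
      Finset.card_filter_add_card_filter_not _
    have h2 : (τ.filter fun a => ¬ a < j) = insert j (τ.filter fun a => j < a) := by
      ext a
      simp only [Finset.mem_filter, Finset.mem_insert, not_lt]
      constructor
      · rintro ⟨h, h'⟩
        rcases h'.eq_or_lt with h' | h'
        · exact Or.inl h'.symm
        · exact Or.inr ⟨h, h'⟩
      · rintro (rfl | ⟨h, h'⟩)
        · exact ⟨hj, le_rfl⟩
        · exact ⟨h, h'.le⟩
    rw [h2, Finset.card_insert_of_notMem (by simp)] at h1
    omega
  have hsq : (-1 : SignType) ^ (τ.filter fun a => a < j).card *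
      (-1 : SignType) ^ (τ.filter fun a => a < j).card = 1 := by
    rcases neg_one_pow_sign (τ.filter fun a => a < j).card with h | h <;> rw [h] <;> decide
  have hd : dVec σ v r x I j =
      (-1 : SignType) ^ (I.filter fun i => j < i).card * σ (insert j I) := by
    simp [dVec, hjI, hB]
  have hc : cVec σ τ j = (-1 : SignType) ^ (τ.filter fun a => a < j).card * σ (τ.erase j) := by
    simp [cVec, hj]
  rw [hd, hc, ← hcard, ssign, pow_add, pow_add]
  generalize (-1 : SignType) ^ (τ.filter fun a => a < j).card = p at *
  generalize (-1 : SignType) ^ (τ.filter fun a => j < a).card = q at *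
  generalize (-1 : SignType) ^ (I.filter fun a => j < a).card = t at *
  generalize σ (insert j I) = y at *
  generalize σ (τ.erase j) = z at *
  clear hd hc
  calc q * t * y * z = (p * p) * (q * t * y * z) := by rw [hsq, one_mul]
    _ = _ := by ac_rfl

theorem orth_main {σ : Finset E → SignType} {v : Finset E → WithTop Γ} {r : ℕ} {x : E → Γ}
    (hσv : ∀ B : Finset E, B.card = r → (σ B = 0 ↔ v B = ⊤))
    (hovm : OrientedValuatedMatroid σ v r)
    {I τ : Finset E} (hI : I.card + 1 = r) (hτ : τ.card = r + 1) {e : E}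
    (he : CMin v x τ e) (hd : dVec σ v r x I e ≠ 0) (δ : SignType) (hδ : δ ≠ 0) :
    ∃ j, CMin v x τ j ∧ cVec σ τ j * dVec σ v r x I j = δ := by
  obtain ⟨heI, heB⟩ := (dVec_ne_zero hσv hI e).1 hd
  obtain ⟨b, hb, hbm⟩ := id heB
  obtain ⟨heτ, a, ha, ham⟩ := id he
  have hmem : ∀ j ∈ τ \ I, (∀ k ∈ τ \ I, v (insert j I) + v (τ.erase j) ≤
      v (insert k I) + v (τ.erase k)) → CMin v x τ j ∧ InitB v r x (insert j I) := by
    intro j hj hk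
    obtain ⟨hjτ, hjI⟩ := Finset.mem_sdiff.1 hj
    have h1 := hk e (by simp [heτ, heI])
    rw [hb, ha] at h1
    have hfin : v (insert j I) + v (τ.erase j) ≠ ⊤ := by
      intro ht; rw [ht, top_le_iff] at h1; exact absurd h1 (by simp [← WithTop.coe_add])
    obtain ⟨hf1, hf2⟩ := WithTop.add_ne_top.1 hfin
    obtain ⟨b', hb'⟩ := WithTop.ne_top_iff_exists.1 hf1
    obtain ⟨a', ha'⟩ := WithTop.ne_top_iff_exists.1 hf2
    rw [← hb', ← ha'] at h1
    have h1' : b' + a' ≤ b + a := by exact_mod_cast h1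
    have h2 := ham j hjτ a' ha'.symm
    have h3 := hbm (insert j I) b' (by rw [Finset.card_insert_of_notMem hjI, hI]) hb'.symm
    have h3' : b - x e ≤ b' - x j := by
      rw [Finset.sum_insert heI, Finset.sum_insert hjI] at h3
      have := add_le_add_left h3 (∑ i ∈ I, x i)
      have e1 : ∀ b y S : Γ, b - (y + S) + S = b - y := by intros; abel
      rwa [e1, e1] at this
    have h4 : a' + x j ≤ a + x e := by
      have := add_le_add h1' h3'
      have e1 : b' + a' + (b - x e) = (a' + x j) + (b' + b - x e - x j) := by abel
      have e2 : b + a + (b' - x j) = (a + x e) + (b' + b - x e - x j) := by abel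
      rw [e1, e2] at this
      exact le_of_add_le_add_right this
    have h5 : b' - x j ≤ b - x e := by
      have := add_le_add h1' h2
      have e1 : b' + a' + (a + x e) = (b' - x j) + (a + a' + x e + x j) := by abel
      have e2 : b + a + (a' + x j) = (b - x e) + (a + a' + x e + x j) := by abel
      rw [e1, e2] at this
      exact le_of_add_le_add_right this
    refine ⟨⟨hjτ, a', ha'.symm, fun k hk a'' ha'' => h4.trans (ham k hk a'' ha'')⟩,
      ⟨b', hb'.symm, fun B' b'' hB' hb'' => le_trans ?_ (hbm B' b'' hB' hb'')⟩⟩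
    rw [Finset.sum_insert heI, Finset.sum_insert hjI, ← sub_sub, ← sub_sub]
    exact sub_le_sub_right h5 _
  rcases hovm I τ hI hτ with h | ⟨⟨j, hj, hjm, hj1⟩, ⟨k, hk, hkm, hk1⟩⟩
  · exfalso
    have := h e (by simp [heτ, heI])
    rw [hb, ha] at this
    exact absurd this (by simp [← WithTop.coe_add])
  · obtain ⟨cj, bj⟩ := hmem j hj hjm
    obtain ⟨ck, bk⟩ := hmem k hk hkm
    rw [ssign_eq hτ cj.1 (Finset.mem_sdiff.1 hj).2 bj] at hj1
    rw [ssign_eq hτ ck.1 (Finset.mem_sdiff.1 hk).2 bk] at hk1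
    have key : ∀ p y z d : SignType, p * y = 1 → p * z = -1 → d ≠ 0 → y = d ∨ z = d := by decide
    rcases key _ _ _ δ hj1 hk1 hδ with h | h
    · exact ⟨j, cj, h⟩
    · exact ⟨k, ck, h⟩

theorem base_main {σ : Finset E → SignType} {v : Finset E → WithTop Γ} {r : ℕ} (x : E → Γ)
    (hσv : ∀ B : Finset E, B.card = r → (σ B = 0 ↔ v B = ⊤))
    (hσ : ∃ B : Finset E, B.card = r ∧ σ B ≠ 0) (e : E) (B : Finset E) (he : e ∉ B) :
    (∃ τ : Finset E, τ.card = r + 1 ∧ cPrime σ v r x τ e ≠ 0 ∧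
      ∀ i, i ≠ e → i ∉ B → cPrime σ v r x τ i = 0) ∨
    (∃ I : Finset E, I.card + 1 = r ∧ dVec σ v r x I e ≠ 0 ∧ ∀ i ∈ B, dVec σ v r x I i = 0) := by
  let S : Finset (Finset E) := Finset.univ.filter fun X => X.card = r ∧ InitB v r x X
  have hS : S.Nonempty := by
    obtain ⟨B0, hB0, hs0⟩ := hσ
    have ht0 : v B0 ≠ ⊤ := fun h => hs0 ((hσv B0 hB0).2 h)
    obtain ⟨X, hX, hXm⟩ := Finset.exists_min_image
      (Finset.univ.filter fun X : Finset E => X.card = r ∧ v X ≠ ⊤)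
      (fun X => (v X).untopD 0 - ∑ i ∈ X, x i) ⟨B0, by simp [hB0, ht0]⟩
    simp only [Finset.mem_filter, Finset.mem_univ, true_and] at hX hXm
    obtain ⟨b, hb⟩ := WithTop.ne_top_iff_exists.1 hX.2
    refine ⟨X, ?_⟩
    simp only [S, Finset.mem_filter, Finset.mem_univ, true_and]
    refine ⟨hX.1, b, hb.symm, fun B' b' hB' hb' => ?_⟩
    have := hXm B' ⟨hB', by simp [hb']⟩
    rw [← hb, hb'] at this
    simpa using this
  obtain ⟨X0, hX0, hX0m⟩ := Finset.exists_max_image S (fun X => (X ∩ B).card) hS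
  have memS : ∀ X, X ∈ S ↔ X.card = r ∧ InitB v r x X := by intro X; simp [S]
  by_cases hex : ∃ X ∈ S, (X ∩ B).card = (X0 ∩ B).card ∧ e ∈ X
  · obtain ⟨X, hXS, hXc, heX⟩ := hex
    right
    have hX := (memS X).1 hXS
    have hI : (X.erase e).card + 1 = r := by rw [Finset.card_erase_add_one heX, hX.1]
    refine ⟨X.erase e, hI, ?_, fun i hi => ?_⟩
    · rw [dVec_ne_zero hσv hI, Finset.insert_erase heX]
      exact ⟨by simp, hX.2⟩
    · by_contra hne
      obtain ⟨h1, h2⟩ := (dVec_ne_zero hσv hI i).1 hne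
      have hm := hX0m (insert i (X.erase e))
        ((memS _).2 ⟨by rw [Finset.card_insert_of_notMem h1, hI], h2⟩)
      have hie : i ≠ e := fun h => he (h ▸ hi)
      have hiX : i ∉ X := fun h => h1 (by simp [hie, h])
      have heq : insert i (X.erase e) ∩ B = insert i (X ∩ B) := by
        ext a
        simp only [Finset.mem_inter, Finset.mem_insert, Finset.mem_erase]
        constructor
        · rintro ⟨h | h, h'⟩
          · exact Or.inl h
          · exact Or.inr ⟨h.2, h'⟩
        · rintro (rfl | ⟨h, h'⟩)
          · exact ⟨Or.inl rfl, hi⟩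
          · exact ⟨Or.inr ⟨fun h'' => he (h'' ▸ h'), h⟩, h'⟩
      rw [heq, Finset.card_insert_of_notMem (by simp [hiX])] at hm
      omega
  · left
    have hX := (memS X0).1 hX0
    have heX : e ∉ X0 := fun h => hex ⟨X0, hX0, rfl, h⟩
    have hτ : (insert e X0).card = r + 1 := by rw [Finset.card_insert_of_notMem heX, hX.1]
    refine ⟨insert e X0, hτ, ?_, fun i hie hi => ?_⟩
    · have hc : e ∈ insert e X0 ∧ InitB v r x ((insert e X0).erase e) := by
        rw [Finset.erase_insert heX]; exact ⟨by simp, hX.2⟩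
      rw [cPrime_eq, if_pos hc]
      exact cVec_ne_zero_of_cmin hσv hτ (cmin_of_initB hτ hc.1 hc.2)
    · rw [cPrime_eq, if_neg]
      rintro ⟨h1, h2⟩
      refine hex ⟨(insert e X0).erase i, (memS _).2 ⟨?_, h2⟩, ?_, ?_⟩
      · rw [Finset.card_erase_of_mem h1, hτ]; rfl
      · congr 1
        ext a
        simp only [Finset.mem_inter, Finset.mem_insert, Finset.mem_erase]
        constructor
        · rintro ⟨⟨_, h | h⟩, h'⟩
          · exact absurd (h ▸ h') he
          · exact ⟨h, h'⟩
        · rintro ⟨h, h'⟩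
          exact ⟨⟨fun h'' => hi (h'' ▸ h'), Or.inr h⟩, h'⟩
      · simp [Ne.symm hie]

/-- If a circuit has an all-nonnegative initial part (after scaling), there is a bad initial
circuit. -/
theorem exists_initial {σ : Finset E → SignType} {v : Finset E → WithTop Γ} {r : ℕ} {x : E → Γ}
    (hσv : ∀ B : Finset E, B.card = r → (σ B = 0 ↔ v B = ⊤))
    (hσ : ∃ B : Finset E, B.card = r ∧ σ B ≠ 0)
    (hovm : OrientedValuatedMatroid σ v r)
    (s : E → SignType) (hs : ∀ i, s i ≠ 0)
    {τ : Finset E} (hτ : τ.card = r + 1) {e : E} (he : CMin v x τ e) (ε : SignType)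
    (hpos : ∀ i, CMin v x τ i → s i * cVec σ τ i ≠ ε) (hε : ε ≠ 0) :
    ∃ τ' : Finset E, τ'.card = r + 1 ∧ cPrime σ v r x τ' ≠ 0 ∧ ∃ η : SignType, η ≠ 0 ∧
      ∀ i, s i * cPrime σ v r x τ' i ≠ η := by
  have hm := minty
    (fun C => ∃ τ' : Finset E, τ'.card = r + 1 ∧ ∃ η : SignType, η ≠ 0 ∧
      ∀ i, C i = η * s i * cPrime σ v r x τ' i)
    (fun D => ∃ I : Finset E, I.card + 1 = r ∧ ∃ η : SignType, η ≠ 0 ∧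
      ∀ i, D i = η * s i * dVec σ v r x I i) e ?_ ?_
  · have hne : ∀ a b c : SignType, a * b * c = 1 → c ≠ 0 := by decide
    rcases hm with ⟨C, ⟨τ', hτ', η, hη, hC⟩, hCe, hC0⟩ | ⟨D, ⟨I, hI, η, hη, hD⟩, hDe, hD0⟩
    · refine ⟨τ', hτ', fun h => ?_, -η, ?_, fun i => ?_⟩
      · rw [hC, h] at hCe
        exact hne _ _ _ hCe rfl
      · exact (by decide : ∀ a : SignType, a ≠ 0 → -a ≠ 0) η hη
      · have := hC0 i
        rw [hC i] at this
        have key : ∀ a b c : SignType, a ≠ 0 → 0 ≤ a * b * c → b * c ≠ -a := by decide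
        exact key _ _ _ hη this
    · exfalso
      rw [hD] at hDe
      obtain ⟨j, hj, hjd⟩ := orth_main hσv hovm hI hτ he (hne _ _ _ hDe) (ε * η) 
        ((by decide : ∀ a b : SignType, a ≠ 0 → b ≠ 0 → a * b ≠ 0) ε η hε hη)
      have h1 := hpos j hj
      have h2 := hD0 j
      rw [hD j] at h2
      have key : ∀ ε η s c d : SignType, ε ≠ 0 → η ≠ 0 → s ≠ 0 → c * d = ε * η → s * c ≠ ε →
        ¬ 0 ≤ η * s * d := by decide
      exact key _ _ _ _ _ hε hη (hs j) hjd h1 h2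
  · rintro C D ⟨τ', hτ', η, hη, hC⟩ ⟨I, hI, θ, hθ, hD⟩ hCe hDe
    have hne : ∀ a b c : SignType, a * b * c = 1 → c ≠ 0 := by decide
    rw [hC] at hCe
    rw [hD] at hDe
    have hc := hne _ _ _ hCe
    have hd := hne _ _ _ hDe
    rw [cPrime_eq] at hc
    have hcb : e ∈ τ' ∧ InitB v r x (τ'.erase e) := by
      by_contra h; rw [if_neg h] at hc; exact hc rfl
    obtain ⟨j, hj, hjd⟩ := orth_main hσv hovm hI hτ' (cmin_of_initB hτ' hcb.1 hcb.2) hd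
      (-(η * θ)) ((by decide : ∀ a b : SignType, a ≠ 0 → b ≠ 0 → -(a * b) ≠ 0) η θ hη hθ)
    refine ⟨j, ?_⟩
    rw [hC j, hD j, cPrime_eq, if_pos ⟨hj.1, initB_of_cmin hcb.1 hcb.2 hj⟩]
    have key : ∀ η θ s c d : SignType, η ≠ 0 → θ ≠ 0 → s ≠ 0 → c * d = -(η * θ) →
      η * s * c * (θ * s * d) = -1 := by decide
    exact key _ _ _ _ _ hη hθ (hs j) hjd
  · intro B hB
    have key : ∀ s c : SignType, s ≠ 0 → c ≠ 0 → (s * c ≠ 0 ∧ s * c * s * c = 1) := by decide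
    rcases base_main x hσv hσ e B hB with ⟨τ', h1, h2, h3⟩ | ⟨I, h1, h2, h3⟩
    · have hk := key _ _ (hs e) h2
      exact Or.inl ⟨fun i => s e * cPrime σ v r x τ' e * s i * cPrime σ v r x τ' i,
        ⟨τ', h1, _, hk.1, fun i => rfl⟩, hk.2, fun i a b => by simp only [h3 i a b, mul_zero]⟩
    · have hk := key _ _ (hs e) h2
      exact Or.inr ⟨fun i => s e * dVec σ v r x I e * s i * dVec σ v r x I i,
        ⟨I, h1, _, hk.1, fun i => rfl⟩, hk.2, fun i a => by simp only [h3 i a, mul_zero]⟩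

end aux

/-- Let `(σ, v)` be an oriented valuated matroid of rank `r`, and let
`(s, x)` be a signed tropical point with all coordinates nonzero. Then `(s, x)` is orthogonal
over `𝕊[Γ]` to every signed valuated circuit of `(σ, v)` iff `s` is a covector of the initial
oriented matroid `σ^x`, i.e. both `+1` and `-1` occur among `s_i · (c'_τ)_i` on the support of
every nonzero circuit vector `c'_τ` of `σ^x`. -/
theorem signed_point_orthogonal_iff_covector_of_initial
    {E : Type*} [Fintype E] [LinearOrder E] {Γ : Type*} [AddCommGroup Γ] [LinearOrder Γ] [IsOrderedAddMonoid Γ]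
    (r : ℕ) (σ : Finset E → SignType) (v : Finset E → WithTop Γ)
    (hσv : ∀ B : Finset E, B.card = r → (σ B = 0 ↔ v B = ⊤))
    (hσ : ∃ B : Finset E, B.card = r ∧ σ B ≠ 0)
    (hovm : OrientedValuatedMatroid σ v r)
    (s : E → SignType) (hs : ∀ i, s i ≠ 0) (x : E → Γ) :
    (∀ τ : Finset E, τ.card = r + 1 → (∃ i : E, cVec σ τ i ≠ 0) →
      ∀ c : E → SignType, (c = cVec σ τ ∨ c = -cVec σ τ) →
        ((∃ i : E, wVec v τ i ≠ ⊤ ∧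
            (∀ j : E, wVec v τ j ≠ ⊤ →
              wVec v τ i + (x i : WithTop Γ) ≤ wVec v τ j + (x j : WithTop Γ)) ∧
            s i * c i = 1) ∧
         (∃ i : E, wVec v τ i ≠ ⊤ ∧
            (∀ j : E, wVec v τ j ≠ ⊤ →
              wVec v τ i + (x i : WithTop Γ) ≤ wVec v τ j + (x j : WithTop Γ)) ∧
            s i * c i = -1))) ↔
    (∀ τ : Finset E, τ.card = r + 1 → cPrime σ v r x τ ≠ 0 →
      ((∃ i : E, cPrime σ v r x τ i ≠ 0 ∧ s i * cPrime σ v r x τ i = 1) ∧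
       (∃ i : E, cPrime σ v r x τ i ≠ 0 ∧ s i * cPrime σ v r x τ i = -1))) := by
  constructor
  · intro H τ hτ hc
    obtain ⟨e, he⟩ := Function.ne_iff.1 hc
    have hcb : e ∈ τ ∧ InitB v r x (τ.erase e) := by
      by_contra h; rw [cPrime_eq, if_neg h] at he; exact he rfl
    have hmin := cmin_of_initB hτ hcb.1 hcb.2
    have tr : ∀ i, CMin v x τ i → cPrime σ v r x τ i = cVec σ τ i := fun i hi => by
      rw [cPrime_eq, if_pos ⟨hi.1, initB_of_cmin hcb.1 hcb.2 hi⟩]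
    obtain ⟨⟨i, hi1, hi2, hi3⟩, ⟨j, hj1, hj2, hj3⟩⟩ :=
      H τ hτ ⟨e, cVec_ne_zero_of_cmin hσv hτ hmin⟩ _ (Or.inl rfl)
    have ci := (cmin_iff v x τ i).2 ⟨hi1, hi2⟩
    have cj := (cmin_iff v x τ j).2 ⟨hj1, hj2⟩
    refine ⟨⟨i, ?_, ?_⟩, ⟨j, ?_, ?_⟩⟩
    · rw [tr i ci]; exact cVec_ne_zero_of_cmin hσv hτ ci
    · rw [tr i ci]; exact hi3
    · rw [tr j cj]; exact cVec_ne_zero_of_cmin hσv hτ cj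
    · rw [tr j cj]; exact hj3
  · intro H τ hτ hc
    obtain ⟨i0, hi0⟩ := hc
    obtain ⟨e, he⟩ := cmin_exists v x τ ⟨i0, (cVec_ne_zero hσv hτ i0).1 hi0⟩
    have main : ∀ ε : SignType, ε ≠ 0 → ∃ i, CMin v x τ i ∧ s i * cVec σ τ i = ε := by
      intro ε hε
      by_contra hcon
      push Not at hcon
      obtain ⟨τ', hτ', hne, η, hη, hall⟩ :=
        exists_initial hσv hσ hovm s hs hτ he ε hcon hε
      obtain ⟨⟨i, _, hi⟩, ⟨j, _, hj⟩⟩ := H τ' hτ' hne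
      have key : ∀ η : SignType, η ≠ 0 → η = 1 ∨ η = -1 := by decide
      rcases key η hη with h | h
      · exact hall i (by rw [h, hi])
      · exact hall j (by rw [h, hj])
    obtain ⟨i, hi, hi'⟩ := main 1 (by decide)
    obtain ⟨j, hj, hj'⟩ := main (-1) (by decide)
    obtain ⟨hi1, hi2⟩ := (cmin_iff v x τ i).1 hi
    obtain ⟨hj1, hj2⟩ := (cmin_iff v x τ j).1 hj
    have key1 : ∀ a b : SignType, a * b = 1 → a * (-b) = -1 := by decide
    have key2 : ∀ a b : SignType, a * b = -1 → a * (-b) = 1 := by decide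
    rintro c (rfl | rfl)
    · exact ⟨⟨i, hi1, hi2, hi'⟩, ⟨j, hj1, hj2, hj'⟩⟩
    · exact ⟨⟨j, hj1, hj2, key2 _ _ hj'⟩, ⟨i, hi1, hi2, key1 _ _ hi'⟩⟩
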